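/- arXiv:2103.02774 — 4 statements merged into one kernel-verified Lean document; each statement's English description precedes it below -/
import Mathlib

section
/- Let X ∈ ℝ^{n×d} be a design matrix, x ∈ ℝ^n a response vector, and θ* ∈ ℝ^d a vector with at most k nonzero entries (k ≥ 1). Suppose the matrix Σ̂ = XᵀX/n satisfies the restricted eigenvalue condition RE(α, τ) with curvature α > 0 and tolerance τ = ((m−1)/m)·α/(32k) for some m > 1, and that the deviation bound ‖(1/n)·Xᵀ(x − Xθ*)‖_∞ ≤ λ/4 holds for some λ > 0. Then any minimizer θ̂ of the LASSO objective (1/n)‖x − Xθ‖₂² + λ‖θ‖₁ satisfies: (i) ‖θ̂ − θ*‖₂ ≤ (3m/(m+1))·√k·λ/α; (ii) ‖θ̂ − θ*‖₁ ≤ (12m/(m+1))·k·λ/α; and (iii) (θ̂ − θ*)ᵀ Σ̂ (θ̂ − θ*) ≤ (18m/(m+1))·k·λ²/α. -/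
open Matrix Finset

/-- The ℓ₁ norm of a finite-dimensional real vector. -/
noncomputable def l1norm {d : ℕ} (v : Fin d → ℝ) : ℝ := ∑ i, |v i|

/-- The Euclidean (ℓ₂) norm of a finite-dimensional real vector. -/
noncomputable def l2norm {d : ℕ} (v : Fin d → ℝ) : ℝ := Real.sqrt (∑ i, (v i) ^ 2)

/-- Proposition 3: prediction error bounds for the LASSO under the restricted
eigenvalue condition and the deviation bound, for a `k`-sparse target `θstar`. -/
theorem lasso_prediction_error_full_model
    {n d k : ℕ} (hn : 0 < n) (hk : 1 ≤ k)
    (X : Matrix (Fin n) (Fin d) ℝ) (x : Fin n → ℝ)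
    (θstar θhat : Fin d → ℝ)
    (α m lam : ℝ) (hα : 0 < α) (hm : 1 < m) (hlam : 0 < lam)
    -- θ* has at most k nonzero entries
    (hsparse : (Finset.univ.filter (fun i => θstar i ≠ 0)).card ≤ k)
    -- restricted eigenvalue condition RE(α, τ) for Σ̂ = XᵀX/n,
    -- with τ = ((m−1)/m)·α/(32k)
    (hRE : ∀ φ : Fin d → ℝ,
      φ ⬝ᵥ (((1 / (n : ℝ)) • (Xᵀ * X)) *ᵥ φ) ≥
        α * (l2norm φ) ^ 2 - ((m - 1) / m * (α / (32 * k))) * (l1norm φ) ^ 2)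
    -- deviation bound: ‖(1/n)·Xᵀ(x − Xθ*)‖_∞ ≤ λ/4
    (hdev : ∀ i : Fin d, |(1 / (n : ℝ)) * (Xᵀ *ᵥ (x - X *ᵥ θstar)) i| ≤ lam / 4)
    -- θ̂ minimizes the LASSO objective
    (hmin : ∀ θ : Fin d → ℝ,
      (1 / (n : ℝ)) * (l2norm (x - X *ᵥ θhat)) ^ 2 + lam * l1norm θhat ≤
        (1 / (n : ℝ)) * (l2norm (x - X *ᵥ θ)) ^ 2 + lam * l1norm θ) :
    l2norm (θhat - θstar) ≤ (3 * m / (m + 1)) * Real.sqrt k * lam / α ∧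
    l1norm (θhat - θstar) ≤ (12 * m / (m + 1)) * k * lam / α ∧
    (θhat - θstar) ⬝ᵥ (((1 / (n : ℝ)) • (Xᵀ * X)) *ᵥ (θhat - θstar)) ≤
      (18 * m / (m + 1)) * k * lam ^ 2 / α := by
  have hn' : (0:ℝ) < n := by exact_mod_cast hn
  have hk' : (1:ℝ) ≤ k := by exact_mod_cast hk
  have l2sq : ∀ {e : ℕ} (v : Fin e → ℝ), l2norm v ^ 2 = v ⬝ᵥ v := by
    intro e v
    unfold l2norm
    rw [Real.sq_sqrt (Finset.sum_nonneg fun i _ => sq_nonneg _)]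
    simp [dotProduct, pow_two]
  obtain ⟨D, hD⟩ : ∃ D, D = θhat - θstar := ⟨_, rfl⟩
  rw [← hD]
  have hQ : D ⬝ᵥ (((1 / (n : ℝ)) • (Xᵀ * X)) *ᵥ D) = (1 / (n:ℝ)) * ((X *ᵥ D) ⬝ᵥ (X *ᵥ D)) := by
    rw [Matrix.smul_mulVec, dotProduct_smul, smul_eq_mul, ← Matrix.mulVec_mulVec,
      Matrix.dotProduct_mulVec, Matrix.vecMul_transpose]
  have hQ0 : 0 ≤ D ⬝ᵥ (((1 / (n : ℝ)) • (Xᵀ * X)) *ᵥ D) := by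
    rw [hQ, ← l2sq]; positivity
  have hre := hRE D
  have hmn := hmin θstar
  obtain ⟨e, he⟩ : ∃ e, e = x - X *ᵥ θstar := ⟨_, rfl⟩
  have hxe : x - X *ᵥ θhat = e - X *ᵥ D := by
    rw [he, hD, Matrix.mulVec_sub]; abel
  rw [hxe, ← he, l2sq, l2sq] at hmn
  rw [← he] at hdev
  have hexp : (e - X *ᵥ D) ⬝ᵥ (e - X *ᵥ D)
      = e ⬝ᵥ e - 2 * ((Xᵀ *ᵥ e) ⬝ᵥ D) + (X *ᵥ D) ⬝ᵥ (X *ᵥ D) := by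
    have h1 : (Xᵀ *ᵥ e) ⬝ᵥ D = e ⬝ᵥ (X *ᵥ D) := by
      rw [Matrix.mulVec_transpose, Matrix.dotProduct_mulVec]
    rw [h1, sub_dotProduct, dotProduct_sub, dotProduct_sub, dotProduct_comm (X *ᵥ D) e]
    ring
  generalize hQd : D ⬝ᵥ (((1 / (n : ℝ)) • (Xᵀ * X)) *ᵥ D) = Q at *
  have hbasic : Q ≤ ∑ i, (2 * ((1 / (n:ℝ)) * (Xᵀ *ᵥ e) i) * D i
      + lam * (|θstar i| - |θhat i|)) := by
    have h2 : ∑ i, (2 * ((1 / (n:ℝ)) * (Xᵀ *ᵥ e) i) * D i + lam * (|θstar i| - |θhat i|))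
        = 2 * (1 / (n:ℝ)) * ((Xᵀ *ᵥ e) ⬝ᵥ D) + lam * (l1norm θstar - l1norm θhat) := by
      unfold l1norm dotProduct
      rw [Finset.sum_add_distrib, ← Finset.sum_sub_distrib, Finset.mul_sum, Finset.mul_sum]
      congr 1
      exact Finset.sum_congr rfl fun i _ => by ring
    rw [h2, hQ]
    rw [hexp] at hmn
    linarith
  have hcoord : ∀ i, 2 * ((1 / (n:ℝ)) * (Xᵀ *ᵥ e) i) * D i + lam * (|θstar i| - |θhat i|)
      ≤ if θstar i ≠ 0 then 3 / 2 * lam * |D i| else - (1 / 2 * lam * |D i|) := by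
    intro i
    have hw : 2 * ((1 / (n:ℝ)) * (Xᵀ *ᵥ e) i) * D i ≤ 1 / 2 * lam * |D i| := by
      have h3 := le_abs_self (((1 / (n:ℝ)) * (Xᵀ *ᵥ e) i) * D i)
      rw [abs_mul] at h3
      have h4 := mul_le_mul_of_nonneg_right (hdev i) (abs_nonneg (D i))
      linarith
    have hDi : D i = θhat i - θstar i := by rw [hD]; rfl
    split_ifs with h
    · have h5 : |θstar i| - |θhat i| ≤ |D i| := by
        rw [hDi, abs_sub_comm]; exact abs_sub_abs_le_abs_sub _ _
      have := mul_le_mul_of_nonneg_left h5 hlam.le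
      linarith
    · have h0 : θstar i = 0 := by simpa using h
      rw [h0, sub_zero] at hDi
      rw [h0, ← hDi, abs_zero]
      linarith
  have hsum := hbasic.trans (Finset.sum_le_sum fun i _ => hcoord i)
  rw [Finset.sum_ite, Finset.sum_neg_distrib, ← Finset.mul_sum, ← Finset.mul_sum] at hsum
  have hl1 : l1norm D = ∑ i with θstar i ≠ 0, |D i| + ∑ i with ¬ θstar i ≠ 0, |D i| := by
    unfold l1norm
    rw [Finset.sum_filter_add_sum_filter_not]
  have hcs : (∑ i with θstar i ≠ 0, |D i|) ^ 2 ≤ k * l2norm D ^ 2 := by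
    refine (sq_sum_le_card_mul_sum_sq).trans ?_
    refine mul_le_mul (by exact_mod_cast hsparse) ?_ (Finset.sum_nonneg fun i _ => sq_nonneg _)
      (by positivity)
    unfold l2norm
    rw [Real.sq_sqrt (Finset.sum_nonneg fun i _ => sq_nonneg _)]
    simp only [sq_abs]
    exact Finset.sum_le_sum_of_subset_of_nonneg (Finset.filter_subset _ _)
      fun i _ _ => sq_nonneg _
  have ha0 : 0 ≤ ∑ i with θstar i ≠ 0, |D i| := Finset.sum_nonneg fun i _ => abs_nonneg _
  have hb0 : 0 ≤ ∑ i with ¬ θstar i ≠ 0, |D i| := Finset.sum_nonneg fun i _ => abs_nonneg _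
  have hv0 : 0 ≤ l2norm D := Real.sqrt_nonneg _
  generalize (∑ i with θstar i ≠ 0, |D i|) = a at *
  generalize (∑ i with ¬ θstar i ≠ 0, |D i|) = b at *
  generalize l2norm D = v at *
  generalize l1norm D = L at *
  clear hexp hmn hQ hbasic hcoord hQd hRE hmin
  obtain ⟨s, hs⟩ : ∃ s, s = Real.sqrt k := ⟨_, rfl⟩
  have hs0 : 0 < s := by rw [hs]; positivity
  have hss : (k:ℝ) = s ^ 2 := by rw [hs, Real.sq_sqrt (by positivity)]
  rw [← hs]
  rw [hss] at hcs hre ⊢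
  have hav : a ≤ s * v := by
    refine abs_le_of_sq_le_sq' ?_ (by positivity) |>.2
    rw [mul_pow]; exact hcs
  have hb : b ≤ 3 * a := by
    by_contra hc
    push Not at hc
    nlinarith [mul_pos hlam (sub_pos.2 hc)]
  have hL : L ≤ 4 * (s * v) := by linarith
  have hQa : Q ≤ 3 / 2 * lam * (s * v) := by
    have := mul_le_mul_of_nonneg_left hav hlam.le
    have := mul_nonneg hlam.le hb0
    linarith
  have hL2 : L ^ 2 ≤ 16 * (s ^ 2 * v ^ 2) := by
    have hL0 : 0 ≤ L := by linarith
    calc L ^ 2 ≤ (4 * (s * v)) ^ 2 := by gcongr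
      _ = _ := by ring
  have hm0 : 0 < m := by linarith
  have hm1 : 0 < m + 1 := by linarith
  have htau : 0 ≤ (m - 1) / m * (α / (32 * s ^ 2)) := by
    have : 0 ≤ m - 1 := by linarith
    positivity
  have hlow : α * v ^ 2 * ((m + 1) / (2 * m)) ≤ Q := by
    have h6 := mul_le_mul_of_nonneg_left hL2 htau
    have h7 : (m - 1) / m * (α / (32 * s ^ 2)) * (16 * (s ^ 2 * v ^ 2))
        = α * v ^ 2 - α * v ^ 2 * ((m + 1) / (2 * m)) := by
      field_simp
      ring
    linarith
  have hv : v ≤ 3 * m / (m + 1) * s * lam / α := by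
    rcases hv0.eq_or_lt with h | h
    · rw [← h]; positivity
    · have h8 : v * (α * v * ((m + 1) / (2 * m))) ≤ v * (3 / 2 * lam * s) := by linarith
      have h9 := le_of_mul_le_mul_left h8 h
      have h10 : α * v * ((m + 1) / (2 * m)) = α * v * (m + 1) / (2 * m) := by ring
      rw [h10, div_le_iff₀ (by positivity)] at h9
      rw [show 3 * m / (m + 1) * s * lam / α = 3 * m * s * lam / ((m + 1) * α) by
        field_simp, le_div_iff₀ (by positivity)]
      linarith
  refine ⟨hv, ?_, ?_⟩
  · have := mul_le_mul_of_nonneg_left hv hs0.le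
    calc L ≤ 4 * (s * (3 * m / (m + 1) * s * lam / α)) := by linarith
      _ = _ := by ring
  · have h11 := mul_le_mul_of_nonneg_left hv (mul_nonneg hlam.le hs0.le)
    have h12 : 0 ≤ m / (m + 1) * s ^ 2 * lam ^ 2 / α := by positivity
    have h13 : 18 * m / (m + 1) * s ^ 2 * lam ^ 2 / α = 18 * (m / (m + 1) * s ^ 2 * lam ^ 2 / α) := by
      ring
    have h14 : lam * s * (3 * m / (m + 1) * s * lam / α) = 3 * (m / (m + 1) * s ^ 2 * lam ^ 2 / α) := by
      ring
    rw [h13]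
    linarith
end

section
/- Let X ∈ ℝ^{n×d} be a design matrix, x ∈ ℝ^n a response vector, and θ* ∈ ℝ^d a vector with at most k nonzero entries (k ≥ 1). Suppose Σ̂ = XᵀX/n satisfies the restricted eigenvalue condition RE(α, τ) with curvature α > 0 and tolerance τ = ((m−1)/m)·α/(32k) for some m > 1, and that ‖(1/n)·Xᵀ(x − Xθ*)‖_∞ ≤ λ/4 for some λ > 0. Then any minimizer θ̂ of the LASSO objective (1/n)‖x − Xθ‖₂² + λ‖θ‖₁ satisfies |ℓ(θ̂) − ℓ(θ*)| ≤ (24m/(m+1))·k·λ²/α, where ℓ(θ) := (1/n)‖x − Xθ‖₂². -/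
open Matrix Finset

/-- The empirical loss ℓ(θ) = (1/n)‖x − Xθ‖₂². -/
noncomputable def empLoss {n d : ℕ} (X : Matrix (Fin n) (Fin d) ℝ) (x : Fin n → ℝ)
    (θ : Fin d → ℝ) : ℝ := (1 / (n : ℝ)) * (l2norm (x - X *ᵥ θ)) ^ 2

theorem aux_l2sq {d : ℕ} (v : Fin d → ℝ) : (l2norm v) ^ 2 = v ⬝ᵥ v := by
  unfold l2norm
  rw [Real.sq_sqrt (Finset.sum_nonneg fun i _ => sq_nonneg _)]
  simp [dotProduct, sq]

theorem aux_expand {n d : ℕ} (X : Matrix (Fin n) (Fin d) ℝ) (x : Fin n → ℝ)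
    (θ δ : Fin d → ℝ) :
    empLoss X x (θ + δ) = empLoss X x θ
      - 2 * ∑ i, ((1 / (n : ℝ)) * (Xᵀ *ᵥ (x - X *ᵥ θ)) i) * δ i
      + δ ⬝ᵥ (((1 / (n : ℝ)) • (Xᵀ * X)) *ᵥ δ) := by
  unfold empLoss
  rw [aux_l2sq, aux_l2sq]
  have h1 : x - X *ᵥ (θ + δ) = (x - X *ᵥ θ) - X *ᵥ δ := by
    rw [mulVec_add]; abel
  rw [h1]
  generalize x - X *ᵥ θ = r
  have h2 : ∑ i, ((1 / (n : ℝ)) * (Xᵀ *ᵥ r) i) * δ i = (1 / (n : ℝ)) * (r ⬝ᵥ (X *ᵥ δ)) := by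
    rw [dotProduct_mulVec, ← mulVec_transpose, dotProduct, Finset.mul_sum]
    exact Finset.sum_congr rfl fun i _ => by ring
  have h3 : δ ⬝ᵥ (((1 / (n : ℝ)) • (Xᵀ * X)) *ᵥ δ)
      = (1 / (n : ℝ)) * ((X *ᵥ δ) ⬝ᵥ (X *ᵥ δ)) := by
    rw [smul_mulVec, dotProduct_smul, ← mulVec_mulVec, dotProduct_mulVec δ, vecMul_transpose,
      smul_eq_mul]
  rw [h2, h3, sub_dotProduct, dotProduct_sub, dotProduct_sub, dotProduct_comm (X *ᵥ δ) r]
  ring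

/-- Proposition 1: deviation result for the full model.  Under the RE condition
with τ = ((m−1)/m)·α/(32k) and the deviation bound, any LASSO minimizer θ̂
satisfies |ℓ(θ̂) − ℓ(θ*)| ≤ (24m/(m+1))·k·λ²/α. -/
theorem lasso_deviation_full_model
    {n d k : ℕ} (hn : 0 < n) (hk : 1 ≤ k)
    (X : Matrix (Fin n) (Fin d) ℝ) (x : Fin n → ℝ)
    (θstar θhat : Fin d → ℝ)
    (α m lam : ℝ) (hα : 0 < α) (hm : 1 < m) (hlam : 0 < lam)
    -- θ* has at most k nonzero entries
    (hsparse : (Finset.univ.filter (fun i => θstar i ≠ 0)).card ≤ k)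
    -- restricted eigenvalue condition RE(α, τ) for Σ̂ = XᵀX/n
    (hRE : ∀ φ : Fin d → ℝ,
      φ ⬝ᵥ (((1 / (n : ℝ)) • (Xᵀ * X)) *ᵥ φ) ≥
        α * (l2norm φ) ^ 2 - ((m - 1) / m * (α / (32 * k))) * (l1norm φ) ^ 2)
    -- deviation bound: ‖(1/n)·Xᵀ(x − Xθ*)‖_∞ ≤ λ/4
    (hdev : ∀ i : Fin d, |(1 / (n : ℝ)) * (Xᵀ *ᵥ (x - X *ᵥ θstar)) i| ≤ lam / 4)
    -- θ̂ minimizes the LASSO objective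
    (hmin : ∀ θ : Fin d → ℝ,
      empLoss X x θhat + lam * l1norm θhat ≤ empLoss X x θ + lam * l1norm θ) :
    |empLoss X x θhat - empLoss X x θstar| ≤ (24 * m / (m + 1)) * k * lam ^ 2 / α := by
  obtain ⟨δ, rfl⟩ : ∃ δ, θhat = θstar + δ := ⟨θhat - θstar, by abel⟩
  have hn' : (0 : ℝ) < n := by exact_mod_cast hn
  have hk' : (1 : ℝ) ≤ k := by exact_mod_cast hk
  have hE := aux_expand X x θstar δ
  have hM := hmin θstar
  have hR := hRE δ
  have hQ0 : 0 ≤ δ ⬝ᵥ (((1 / (n : ℝ)) • (Xᵀ * X)) *ᵥ δ) := by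
    rw [smul_mulVec, dotProduct_smul, ← mulVec_mulVec, dotProduct_mulVec δ, vecMul_transpose,
      smul_eq_mul]
    exact mul_nonneg (by positivity) (Finset.sum_nonneg fun i _ => mul_self_nonneg _)
  set S := Finset.univ.filter (fun i => θstar i ≠ 0) with hS
  obtain ⟨a, ha⟩ : ∃ a, a = ∑ i ∈ S, |δ i| := ⟨_, rfl⟩
  obtain ⟨b, hb⟩ : ∃ b, b = ∑ i ∈ Finset.univ.filter (fun i => ¬ θstar i ≠ 0), |δ i| := ⟨_, rfl⟩
  have ha0 : 0 ≤ a := ha ▸ Finset.sum_nonneg fun i _ => abs_nonneg _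
  have hb0 : 0 ≤ b := hb ▸ Finset.sum_nonneg fun i _ => abs_nonneg _
  have hab : l1norm δ = a + b := by
    rw [ha, hb, hS, l1norm, Finset.sum_filter_add_sum_filter_not]
  have he : l1norm θstar - l1norm (θstar + δ) ≤ a - b := by
    rw [ha, hb, hS, Finset.sum_filter, Finset.sum_filter, l1norm, l1norm,
      ← Finset.sum_sub_distrib, ← Finset.sum_sub_distrib]
    refine Finset.sum_le_sum fun i _ => ?_
    by_cases h : θstar i = 0
    · simp [h]
    · have := abs_sub_abs_le_abs_sub (θstar i) (θstar i + δ i)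
      simpa [h] using this
  have hg : |∑ i, ((1 / (n : ℝ)) * (Xᵀ *ᵥ (x - X *ᵥ θstar)) i) * δ i| ≤ lam / 4 * (a + b) := by
    rw [← hab, l1norm, Finset.mul_sum]
    refine (Finset.abs_sum_le_sum_abs _ _).trans (Finset.sum_le_sum fun i _ => ?_)
    rw [abs_mul]
    exact mul_le_mul_of_nonneg_right (hdev i) (abs_nonneg _)
  have hg' := abs_le.mp hg
  obtain ⟨N, hN⟩ : ∃ N, N = (l2norm δ) ^ 2 := ⟨_, rfl⟩
  have haN : a ^ 2 ≤ k * N := by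
    have h1 : a ^ 2 ≤ S.card * ∑ i ∈ S, |δ i| ^ 2 := by
      rw [ha]; exact sq_sum_le_card_mul_sum_sq
    have h2 : ∑ i ∈ S, |δ i| ^ 2 ≤ N := by
      rw [hN, aux_l2sq, dotProduct]
      simp only [sq_abs, ← sq]
      exact Finset.sum_le_sum_of_subset_of_nonneg (Finset.subset_univ _)
        fun i _ _ => sq_nonneg _
    have h3 : (S.card : ℝ) ≤ k := by exact_mod_cast hsparse
    have h4 : 0 ≤ ∑ i ∈ S, |δ i| ^ 2 := Finset.sum_nonneg fun i _ => sq_nonneg _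
    exact h1.trans (mul_le_mul h3 h2 h4 (by linarith))
  rw [← hN, hab] at hR
  generalize δ ⬝ᵥ (((1 / (n : ℝ)) • (Xᵀ * X)) *ᵥ δ) = Q at *
  generalize ∑ i, ((1 / (n : ℝ)) * (Xᵀ *ᵥ (x - X *ᵥ θstar)) i) * δ i = G at *
  have hle : lam * (l1norm θstar - l1norm (θstar + δ)) ≤ lam * (a - b) :=
    mul_le_mul_of_nonneg_left he hlam.le
  have hQ : Q ≤ 3 / 2 * lam * a - 1 / 2 * lam * b := by linarith
  have hb3 : b ≤ 3 * a := by
    have : lam * b ≤ lam * (3 * a) := by linarith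
    exact le_of_mul_le_mul_left this hlam
  -- bound on a
  have hm0 : 0 < m := by linarith
  have hτ : ((m - 1) / m * (α / (32 * k))) * (a + b) ^ 2 ≤ (m - 1) / m * (α / 2) * N := by
    have h1 : (a + b) ^ 2 ≤ 16 * (k * N) := by nlinarith
    have h2 : 0 ≤ (m - 1) / m * (α / (32 * k)) :=
      mul_nonneg (div_nonneg (by linarith) hm0.le) (by positivity)
    refine (mul_le_mul_of_nonneg_left h1 h2).trans (le_of_eq ?_)
    field_simp
    ring
  have hc : α * ((m + 1) / (2 * m)) * N ≤ 3 / 2 * lam * a := by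
    have : α * ((m + 1) / (2 * m)) * N = α * N - (m - 1) / m * (α / 2) * N := by
      field_simp
      ring
    have : 0 ≤ lam * b := mul_nonneg hlam.le hb0
    linarith
  have hA : a ≤ 3 * m / (m + 1) * k * lam / α := by
    rcases ha0.eq_or_lt with h | h
    · rw [← h]; positivity
    have hcp : 0 < α * ((m + 1) / (2 * m)) := by positivity
    have h1 : α * ((m + 1) / (2 * m)) * a ^ 2 ≤ k * (3 / 2 * lam * a) := by
      calc _ ≤ α * ((m + 1) / (2 * m)) * (k * N) := mul_le_mul_of_nonneg_left haN hcp.le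
        _ = k * (α * ((m + 1) / (2 * m)) * N) := by ring
        _ ≤ _ := mul_le_mul_of_nonneg_left hc (by linarith)
    have h2 : α * ((m + 1) / (2 * m)) * a ≤ k * (3 / 2 * lam) := by
      refine le_of_mul_le_mul_right ?_ h
      linarith
    refine le_of_mul_le_mul_left (h2.trans (le_of_eq ?_)) hcp
    field_simp
  have hF : 8 * lam * a ≤ (24 * m / (m + 1)) * k * lam ^ 2 / α := by
    calc _ ≤ 8 * lam * (3 * m / (m + 1) * k * lam / α) :=
          mul_le_mul_of_nonneg_left hA (by positivity)
      _ = _ := by ring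
  have hla : 0 ≤ lam * a := mul_nonneg hlam.le ha0
  have hlb : 0 ≤ lam * b := mul_nonneg hlam.le hb0
  have hlb3 : lam * b ≤ lam * (3 * a) := mul_le_mul_of_nonneg_left hb3 hlam.le
  refine le_trans (abs_le.mpr ⟨?_, ?_⟩) hF
  · linarith [hM, hle, hE, hg'.1, hg'.2]
  · linarith [hM, hle, hE, hg'.1, hg'.2]
end

section
/- Let Σ̂ ∈ ℝ^{p×p} be a symmetric matrix satisfying the restricted eigenvalue condition RE(α, τ) with curvature α > 0 and tolerance τ = ((m−1)/m)·α/(32k) for some m > 1 and some integer k ≥ 1. Then for any vector ṽ ∈ ℝ^p and any b ≥ 0 such that ‖ṽ‖₁ ≤ 4√k·‖ṽ‖₂ + 4b, one has ṽᵀ Σ̂ ṽ ≥ (α/m)·‖ṽ‖₂² − (α/m)·((m−1)/k)·b². -/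
open Matrix

/-- Restricted strong convexity over an approximate cone (equation
(restricted-RE-condition) in the proof of Proposition 4): if Σ̂ satisfies
RE(α, τ) with τ = ((m−1)/m)·α/(32k), then for any ṽ with
‖ṽ‖₁ ≤ 4√k‖ṽ‖₂ + 4b one has ṽᵀΣ̂ṽ ≥ (α/m)‖ṽ‖₂² − (α/m)((m−1)/k)b². -/
theorem restricted_strong_convexity_on_cone
    {p k : ℕ} (hk : 1 ≤ k)
    (Sig : Matrix (Fin p) (Fin p) ℝ) (hsym : Sigᵀ = Sig)
    (α m : ℝ) (hα : 0 < α) (hm : 1 < m)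
    (hRE : ∀ φ : Fin p → ℝ,
      φ ⬝ᵥ (Sig *ᵥ φ) ≥
        α * (l2norm φ) ^ 2 - ((m - 1) / m * (α / (32 * k))) * (l1norm φ) ^ 2)
    (v : Fin p → ℝ) (b : ℝ) (hb : 0 ≤ b)
    (hcone : l1norm v ≤ 4 * Real.sqrt k * l2norm v + 4 * b) :
    v ⬝ᵥ (Sig *ᵥ v) ≥
      (α / m) * (l2norm v) ^ 2 - (α / m) * ((m - 1) / k) * b ^ 2 := by
  have hk0 : (0:ℝ) < k := by exact_mod_cast hk
  have hm0 : (0:ℝ) < m := by linarith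
  have h1 : 0 ≤ l1norm v := Finset.sum_nonneg fun i _ => abs_nonneg _
  have hs : Real.sqrt k ^ 2 = k := Real.sq_sqrt hk0.le
  have hsq : (l1norm v) ^ 2 ≤ 32 * k * (l2norm v) ^ 2 + 32 * b ^ 2 := by
    have h2 : (l1norm v) ^ 2 ≤ (4 * Real.sqrt k * l2norm v + 4 * b) ^ 2 :=
      pow_le_pow_left₀ h1 hcone 2
    have h3 := sq_nonneg (4 * Real.sqrt k * l2norm v - 4 * b)
    have h4 : (Real.sqrt k * l2norm v) ^ 2 = k * (l2norm v) ^ 2 := by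
      rw [mul_pow, hs]
    nlinarith
  have ht : 0 ≤ (m - 1) / m * (α / (32 * k)) := by
    have : 0 ≤ m - 1 := by linarith
    positivity
  have h5 := mul_le_mul_of_nonneg_left hsq ht
  have h6 : (m - 1) / m * (α / (32 * k)) * (32 * k * (l2norm v) ^ 2 + 32 * b ^ 2)
      = α * (l2norm v) ^ 2 - (α / m) * (l2norm v) ^ 2
        + (α / m) * ((m - 1) / k) * b ^ 2 := by
    field_simp
  have h7 := hRE v
  linarith
end

section
/- Let 𝓉 > 0 and t > 0, set γ := (𝓉 + 2)/𝓉 and s := 1 + γt. Let σ² > 0 and let L_F, L̂_F, L̂_R be real numbers with |L_F − σ²| ≤ σ²/s, |L̂_F − L_F| ≤ σ²·t/s, and |L̂_R − L_F| ≤ σ²·t/s. Then L̂_F > 0 and the statistic T := L̂_R/L̂_F − 1 satisfies T ≤ (2t/s)/(1 − (1+t)/s) = 𝓉. -/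
/-- Key deterministic step in the proof of Corollary 1: with γ = (𝓉+2)/𝓉 and
s = 1 + γt, the concentration bounds imply L̂_F > 0 and the LGC statistic
T = L̂_R/L̂_F − 1 is at most (2t/s)/(1 − (1+t)/s), which equals 𝓉 exactly. -/
theorem lgc_threshold_exact_null_bound
    (𝓉 t : ℝ) (h𝓉 : 0 < 𝓉) (ht : 0 < t)
    (σsq : ℝ) (hσ : 0 < σsq)
    (LF LFhat LRhat : ℝ)
    (hN : |LF - σsq| ≤ σsq / (1 + (𝓉 + 2) / 𝓉 * t))
    (hF : |LFhat - LF| ≤ σsq * t / (1 + (𝓉 + 2) / 𝓉 * t))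
    (hR : |LRhat - LF| ≤ σsq * t / (1 + (𝓉 + 2) / 𝓉 * t)) :
    0 < LFhat ∧
      LRhat / LFhat - 1 ≤
        (2 * t / (1 + (𝓉 + 2) / 𝓉 * t)) /
          (1 - (1 + t) / (1 + (𝓉 + 2) / 𝓉 * t)) ∧
      (2 * t / (1 + (𝓉 + 2) / 𝓉 * t)) /
          (1 - (1 + t) / (1 + (𝓉 + 2) / 𝓉 * t)) = 𝓉 := by
  obtain ⟨s, hs⟩ : ∃ s, s = 1 + (𝓉 + 2) / 𝓉 * t := ⟨_, rfl⟩
  rw [← hs] at hN hF hR ⊢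
  have hs1 : s = 1 + t + 2 * t / 𝓉 := by rw [hs]; field_simp; ring
  have hq : 0 < 2 * t / 𝓉 := by positivity
  have hs0 : 0 < s := by rw [hs1]; positivity
  have heq : (2 * t / s) / (1 - (1 + t) / s) = 𝓉 := by
    have h1 : 1 - (1 + t) / s = (2 * t / 𝓉) / s := by
      rw [eq_div_iff hs0.ne', sub_mul, div_mul_cancel₀ _ hs0.ne']
      linarith
    rw [h1]
    field_simp
  obtain ⟨u, hu⟩ : ∃ u, u = σsq / s := ⟨_, rfl⟩
  have hu0 : 0 < u := by rw [hu]; positivity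
  have hσu : σsq = u * s := by rw [hu]; field_simp
  have hut : σsq * t / s = u * t := by rw [hu]; ring
  rw [← hu] at hN
  rw [hut] at hF hR
  have hN' := abs_le.mp hN
  have hF' := abs_le.mp hF
  have hR' := abs_le.mp hR
  have hexp : u * s = u + u * t + u * (2 * t / 𝓉) := by rw [hs1]; ring
  have hlow : u * (2 * t / 𝓉) ≤ LFhat := by linarith [hN'.1, hF'.1]
  have hpos : 0 < LFhat := lt_of_lt_of_le (mul_pos hu0 hq) hlow
  refine ⟨hpos, ?_, heq⟩
  rw [heq, sub_le_iff_le_add, div_le_iff₀ hpos]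
  have h2 : 𝓉 * (u * (2 * t / 𝓉)) = 2 * (u * t) := by field_simp
  have h3 := mul_le_mul_of_nonneg_left hlow h𝓉.le
  linarith [hR'.2, hF'.1]
end
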